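/- arXiv:1302.0073 — 3 statements merged into one kernel-verified Lean document; each statement's English description precedes it below -/
import Mathlib

section
/- Let n ≥ 0 be an integer, and for each 0 ≤ j ≤ n let b_{j,n}(T) be the extremal polynomial. Then for every odd prime p with 3 ≤ p ≤ 2n+1 and every integer k ≥ 1, one has the exact equality binom(kp−1, p−1) = Σ_{j=0}^{n} b_{j,n}(k)·p^j·H({1}^j; p−1). -/
open Finset Polynomial

/-- The multiple harmonic sum `H({1}^j; m)`: the `j`-th elementary symmetric
polynomial evaluated at `1, 1/2, ..., 1/m`. -/
noncomputable def mhs (j m : ℕ) : ℚ :=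
  ∑ s ∈ Finset.powersetCard j (Finset.Icc 1 m), ∏ i ∈ s, (1 : ℚ) / i

/-- The generating function of the multiple harmonic sums `H({1}^j; m)`. -/
theorem prod_one_add_C_mul_eq_sum_mhs (m : ℕ) (c : ℚ) (Y : ℚ[X]) :
    ∏ i ∈ Icc 1 m, (1 + C (c / i) * Y) = ∑ j ∈ range (m + 1), C (c ^ j * mhs j m) * Y ^ j := by
  rw [Finset.prod_one_add, Finset.sum_powerset]
  simp only [Nat.card_Icc, Nat.add_sub_cancel]
  refine Finset.sum_congr rfl fun j _ => ?_
  rw [mhs, Finset.mul_sum, map_sum, Finset.sum_mul]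
  refine Finset.sum_congr rfl fun s hs => ?_
  rw [Finset.prod_mul_distrib, Finset.prod_const, (mem_powersetCard.1 hs).2, ← map_prod]
  simp only [div_eq_mul_inv, one_mul, Finset.prod_mul_distrib, Finset.prod_const,
    (mem_powersetCard.1 hs).2]

theorem cast_add_choose_eq_prod (a m : ℕ) :
    ((a + m).choose m : ℚ) = ∏ i ∈ Icc 1 m, (1 + (a : ℚ) / i) := by
  induction m with
  | zero => simp
  | succ m ih =>
    rw [Finset.prod_Icc_succ_top (by lia), ← ih]
    have h : ((a + m + 1 : ℕ) : ℚ) * ((a + m).choose m : ℚ) =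
        ((a + m + 1).choose (m + 1) : ℚ) * ((m + 1 : ℕ) : ℚ) := by
      exact_mod_cast Nat.add_one_mul_choose_eq (a + m) m
    rw [← add_assoc]
    push_cast at h ⊢
    field_simp
    linear_combination -h

/-- The reflection `T ↦ 1 - T` fixes `∏ i, (1 + (m + 1) / i * (T - 1))` when `m` is even. -/
theorem prod_one_add_reflect {m : ℕ} (hm : Even m) :
    ∏ i ∈ Icc 1 m, (1 + C (((m + 1 : ℕ) : ℚ) / i) * (X - 1)) =
      ∏ i ∈ Icc 1 m, (1 + C (((m + 1 : ℕ) : ℚ) / i) * (-X)) := by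
  have hL : ∀ i ∈ Icc 1 m, (1 + C (((m + 1 : ℕ) : ℚ) / i) * (X - 1)) =
      C ((i : ℚ)⁻¹) * (C (i : ℚ) + C ((m + 1 : ℕ) : ℚ) * (X - 1)) := by
    intro i hi
    have : (i : ℚ) ≠ 0 := by simp at hi ⊢; lia
    rw [mul_add, ← C_mul, inv_mul_cancel₀ this, ← mul_assoc, ← C_mul, div_eq_inv_mul, C_1]
  have hR : ∀ i ∈ Icc 1 m, (1 + C (((m + 1 : ℕ) : ℚ) / i) * (-X)) =
      C ((i : ℚ)⁻¹) * (C (i : ℚ) + C ((m + 1 : ℕ) : ℚ) * (-X)) := by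
    intro i hi
    have : (i : ℚ) ≠ 0 := by simp at hi ⊢; lia
    rw [mul_add, ← C_mul, inv_mul_cancel₀ this, ← mul_assoc, ← C_mul, div_eq_inv_mul, C_1]
  rw [Finset.prod_congr rfl hL, Finset.prod_congr rfl hR, Finset.prod_mul_distrib,
    Finset.prod_mul_distrib]
  congr 1
  have hneg : ∏ i ∈ Icc 1 m, (C (i : ℚ) + C ((m + 1 : ℕ) : ℚ) * (-X)) =
      ∏ i ∈ Icc 1 m, -(C (i : ℚ) + C ((m + 1 : ℕ) : ℚ) * (-X)) := by
    rw [Finset.prod_neg, Nat.card_Icc, Nat.add_sub_cancel, hm.neg_one_pow, one_mul]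
  rw [hneg]
  refine Finset.prod_nbij' (fun i => m + 1 - i) (fun i => m + 1 - i)
    (by simp; lia) (by simp; lia) (by simp; lia) (by simp; lia) ?_
  intro i hi
  rw [Nat.cast_sub (by simp at hi; lia), C_sub]
  ring

/-- If `f j ≡ Y ^ j` modulo `Y ^ (n + 1)` for `j ≤ n`, the truncated combination of the `f j` is
congruent to the full combination of the `Y ^ j`. -/
theorem pow_dvd_sum_sub_sum {R : Type*} [CommRing R] {n N : ℕ} (hN : n + 1 ≤ N) (Y : R)
    (f a : ℕ → R) (h : ∀ j ≤ n, Y ^ (n + 1) ∣ f j - Y ^ j) :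
    Y ^ (n + 1) ∣ ∑ j ∈ range (n + 1), a j * f j - ∑ j ∈ range N, a j * Y ^ j := by
  rw [← Finset.sum_range_add_sum_Ico _ hN, ← sub_sub, ← Finset.sum_sub_distrib]
  refine dvd_sub (Finset.dvd_sum fun j hj => ?_) (Finset.dvd_sum fun j hj => ?_)
  · rw [← mul_sub]
    exact (h j (by simp at hj; lia)).mul_left _
  · exact (pow_dvd_pow Y (mem_Ico.1 hj).1).mul_left _

theorem mhs_eq_zero_of_lt {j m : ℕ} (h : m < j) : mhs j m = 0 := by
  rw [mhs, Finset.powersetCard_eq_empty.2 (by simpa using h), Finset.sum_empty]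

theorem stmt2 (n : ℕ) (b : ℕ → Polynomial ℚ)
    (hdeg : ∀ j ≤ n, (b j).natDegree ≤ 2 * n + 1)
    (hb1 : ∀ j ≤ n, (X - 1) ^ (n + 1) ∣ b j - (X - 1) ^ j)
    (hb2 : ∀ j ≤ n, X ^ (n + 1) ∣ b j - (-1) ^ j * X ^ j) :
    ∀ p : ℕ, p.Prime → Odd p → 3 ≤ p → p ≤ 2 * n + 1 → ∀ k : ℕ, 1 ≤ k →
      ((k * p - 1).choose (p - 1) : ℚ) =
        ∑ j ∈ Finset.range (n + 1), (b j).eval (k : ℚ) * (p : ℚ) ^ j * mhs j (p - 1) := by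
  intro p _ hodd _ hpn k hk
  obtain ⟨m, rfl⟩ : ∃ m, p = m + 1 := ⟨p - 1, by lia⟩
  have hm : Even m := by simpa [parity_simps] using hodd
  rw [Nat.add_sub_cancel]
  set a : ℕ → ℚ[X] := fun j => C (((m + 1 : ℕ) : ℚ) ^ j * mhs j m) with ha
  have hext : ∀ Y : ℚ[X], ∏ i ∈ Icc 1 m, (1 + C (((m + 1 : ℕ) : ℚ) / i) * Y) =
      ∑ j ∈ range (2 * n + 2), a j * Y ^ j := by
    intro Y
    rw [prod_one_add_C_mul_eq_sum_mhs]
    refine Finset.sum_subset (by simpa using by lia) fun j _ hj => ?_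
    simp [mhs_eq_zero_of_lt (show m < j by simp at hj; lia)]
  set P : ℚ[X] := ∏ i ∈ Icc 1 m, (1 + C (((m + 1 : ℕ) : ℚ) / i) * (X - 1)) with hP
  set Q : ℚ[X] := ∑ j ∈ range (n + 1), a j * b j with hQ
  have h1 : (X - 1) ^ (n + 1) ∣ Q - P := by
    rw [hP, hext]
    exact pow_dvd_sum_sub_sum (by lia) _ _ _ hb1
  have h2 : X ^ (n + 1) ∣ Q - P := by
    rw [hP, prod_one_add_reflect hm, hext]
    have hX : (-X : ℚ[X]) ^ (n + 1) ∣ Q - ∑ j ∈ range (2 * n + 2), a j * (-X) ^ j := by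
      refine pow_dvd_sum_sub_sum (by lia) _ _ _ fun j hj => ?_
      rw [neg_pow (X : ℚ[X]) j]
      exact (pow_dvd_pow_of_dvd (neg_dvd.2 (dvd_refl (X : ℚ[X]))) _).trans (hb2 j hj)
    exact (pow_dvd_pow_of_dvd (dvd_neg.2 (dvd_refl (X : ℚ[X]))) _).trans hX
  have hcop : IsCoprime (X ^ (n + 1) : ℚ[X]) ((X - 1) ^ (n + 1)) :=
    IsCoprime.pow ⟨1, -1, by ring⟩
  have hmonic : ((X : ℚ[X]) ^ (n + 1) * (X - 1) ^ (n + 1)).Monic :=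
    (monic_X_pow _).mul ((monic_X_sub_C (1 : ℚ)).pow _)
  have hnat : ((X : ℚ[X]) ^ (n + 1) * (X - 1) ^ (n + 1)).natDegree = 2 * n + 2 := by
    rw [← C_1, (monic_X_pow _).natDegree_mul ((monic_X_sub_C (1 : ℚ)).pow _),
      natDegree_X_pow, natDegree_pow, natDegree_X_sub_C]
    ring
  have hQdeg : Q.natDegree ≤ 2 * n + 1 :=
    natDegree_sum_le_of_forall_le _ _ fun j hj =>
      (natDegree_C_mul_le _ _).trans (hdeg j (by simp at hj; lia))
  have hPdeg : P.natDegree ≤ 2 * n + 1 := by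
    rw [hP, hext]
    refine natDegree_sum_le_of_forall_le _ _ fun j hj => (natDegree_C_mul_le _ _).trans ?_
    rw [← C_1, natDegree_pow, natDegree_X_sub_C]
    simp at hj; lia
  have hQP : Q - P = 0 := by
    by_contra hne
    have hle := natDegree_le_of_dvd (hcop.mul_dvd h2 h1) hne
    have := natDegree_sub_le_of_le hQdeg hPdeg
    rw [hnat] at hle
    simp at this
    lia
  obtain ⟨k, rfl⟩ : ∃ l, k = l + 1 := ⟨k - 1, by lia⟩
  have hchoose : (k + 1) * (m + 1) - 1 = k * (m + 1) + m := by
    rw [Nat.add_one_mul]; lia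
  rw [hchoose, cast_add_choose_eq_prod]
  calc _ = P.eval ((k + 1 : ℕ) : ℚ) := by
        rw [hP, eval_prod]
        refine Finset.prod_congr rfl fun i _ => ?_
        simp
        ring
    _ = Q.eval ((k + 1 : ℕ) : ℚ) := by rw [sub_eq_zero.1 hQP]
    _ = _ := by
        rw [hQ, eval_finsetSum]
        refine Finset.sum_congr rfl fun j _ => ?_
        rw [ha, eval_mul, eval_C]
        ring
end

section
/- Let n ≥ 0 be an integer, let p ≥ 2n+5 be a prime, let k be an integer, and for each 0 ≤ j ≤ n let b_{j,n}(T) be the extremal polynomial. Then the p-adic valuation of binom(kp−1, p−1) − Σ_{j=0}^{n} b_{j,n}(k)·p^j·H({1}^j; p−1) is at least 2n+4 if and only if either k ≡ 0 (mod p), or k ≡ 1 (mod p), or p divides the numerator of the Bernoulli number B_{p−2n−3}. -/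
open Finset Polynomial

/-- The subring of `ℚ` of the `p`-integral rational numbers. -/
def pIntegral (p : ℕ) [Fact p.Prime] : Subring ℚ where
  carrier := {x | padicNorm p x ≤ 1}
  mul_mem' {a b} ha hb := by
    simp only [Set.mem_ofPred_eq] at *
    rw [padicNorm.mul]
    exact mul_le_one₀ ha (padicNorm.nonneg _) hb
  one_mem' := by simp
  add_mem' {a b} ha hb := padicNorm.nonarchimedean.trans (max_le ha hb)
  zero_mem' := by simp
  neg_mem' {a} ha := by simpa [padicNorm.neg] using ha

theorem mem_pIntegral {p : ℕ} [Fact p.Prime] {x : ℚ} :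
    x ∈ pIntegral p ↔ padicNorm p x ≤ 1 := Iff.rfl

section

variable {p : ℕ} [hp : Fact p.Prime]

theorem natCast_inv_mem_pIntegral {m : ℕ} (h0 : 0 < m) (hm : m < p) :
    (m : ℚ)⁻¹ ∈ pIntegral p := by
  have h : padicNorm p (m : ℚ) = 1 :=
    (padicNorm.nat_eq_one_iff m).2 (Nat.not_dvd_of_pos_of_lt h0 hm)
  rw [mem_pIntegral, ← one_div, padicNorm.div, h]
  simp

theorem bernoulli'_mem_pIntegral (m : ℕ) (hm : m + 2 ≤ p) : bernoulli' m ∈ pIntegral p := by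
  induction m using Nat.strong_induction_on with
  | _ m ih =>
    rw [bernoulli'_def]
    refine sub_mem (one_mem _) (sum_mem fun k hk => ?_)
    have hk' := Finset.mem_range.1 hk
    refine mul_mem ?_ (ih k hk' (by omega))
    rw [div_eq_mul_inv]
    have h : (m : ℚ) - k + 1 = ((m - k + 1 : ℕ) : ℚ) := by
      push_cast [Nat.cast_sub hk'.le]; ring
    rw [h]
    exact mul_mem (natCast_mem _ _) (natCast_inv_mem_pIntegral (by omega) (by omega))

theorem bernoulli_mem_pIntegral (m : ℕ) (hm : m + 2 ≤ p) :
    _root_.bernoulli m ∈ pIntegral p := by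
  rw [_root_.bernoulli]
  exact mul_mem (pow_mem (neg_mem (one_mem _)) _) (bernoulli'_mem_pIntegral m hm)

/-- Power sums over a full residue system, modulo `p ^ 2`. -/
theorem sum_range_pow_eq_prime_mul_bernoulli_add (r : ℕ) (hr : r + 2 ≤ p) :
    ∃ w ∈ pIntegral p,
      ∑ i ∈ range p, (i : ℚ) ^ r = p * _root_.bernoulli r + (p : ℚ) ^ 2 * w := by
  have hr1 : (r + 1 : ℚ) ≠ 0 := by positivity
  refine ⟨∑ i ∈ range r, _root_.bernoulli i * ((r + 1).choose i) * (p : ℚ) ^ (r - 1 - i) *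
    ((r + 1 : ℕ) : ℚ)⁻¹, sum_mem fun i hi => ?_, ?_⟩
  · have := Finset.mem_range.1 hi
    exact mul_mem (mul_mem (mul_mem (bernoulli_mem_pIntegral i (by omega)) (natCast_mem _ _))
      (pow_mem (natCast_mem _ _) _)) (natCast_inv_mem_pIntegral (by omega) (by omega))
  · rw [sum_range_pow, Finset.sum_range_succ, add_comm, Finset.mul_sum]
    congr 1
    · rw [Nat.choose_succ_self_right, Nat.add_sub_cancel_left]
      push_cast
      field_simp
    · refine Finset.sum_congr rfl fun i hi => ?_
      have := Finset.mem_range.1 hi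
      rw [show r + 1 - i = 2 + (r - 1 - i) by omega, pow_add]
      push_cast
      ring

end

/-- The `j`-th elementary symmetric polynomial evaluated at `1, 2, ..., m`. -/
def esymmIcc (j m : ℕ) : ℚ :=
  ∑ s ∈ Finset.powersetCard j (Finset.Icc 1 m), ∏ i ∈ s, (i : ℚ)

theorem esymmIcc_zero (m : ℕ) : esymmIcc 0 m = 1 := by simp [esymmIcc]

theorem mul_esymmIcc_eq_sum (r m : ℕ) :
    r * esymmIcc r m = (-1) ^ (r + 1) * ∑ a ∈ antidiagonal r with a.1 < r,
      (-1) ^ a.1 * esymmIcc a.1 m * ∑ i ∈ Finset.Icc 1 m, (i : ℚ) ^ a.2 := by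
  have hE : ∀ j, MvPolynomial.aeval (fun i : Finset.Icc 1 m => ((i : ℕ) : ℚ))
      (MvPolynomial.esymm (Finset.Icc 1 m) ℚ j) = esymmIcc j m := by
    intro j
    rw [MvPolynomial.aeval_esymm_eq_multiset_esymm, esymmIcc, ← Finset.esymm_map_val]
    congr 1
    exact congrArg Finset.val (Finset.attach_map_val (s := Finset.Icc 1 m)) ▸ by
      simp [Multiset.map_map]
  have hP : ∀ j, MvPolynomial.aeval (fun i : Finset.Icc 1 m => ((i : ℕ) : ℚ))
      (MvPolynomial.psum (Finset.Icc 1 m) ℚ j) = ∑ i ∈ Finset.Icc 1 m, (i : ℚ) ^ j := by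
    intro j
    simp only [MvPolynomial.psum, map_sum, map_pow, MvPolynomial.aeval_X]
    exact Finset.sum_coe_sort (Finset.Icc 1 m) fun i => (i : ℚ) ^ j
  have h := congrArg (MvPolynomial.aeval (fun i : Finset.Icc 1 m => ((i : ℕ) : ℚ)))
    (MvPolynomial.mul_esymm_eq_sum (Finset.Icc 1 m) ℚ r)
  simpa only [map_mul, map_natCast, map_pow, map_neg, map_one, map_sum, hE, hP] using h

theorem cast_factorial_eq_prod_Icc (m : ℕ) :
    (m.factorial : ℚ) = ∏ i ∈ Finset.Icc 1 m, (i : ℚ) := by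
  rw [← Finset.prod_Ico_id_eq_factorial, Nat.cast_prod]
  rfl

theorem mhs_mul_factorial {j m : ℕ} (hj : j ≤ m) :
    mhs j m * m.factorial = esymmIcc (m - j) m := by
  have hcard : (Finset.Icc 1 m).card = m := by simp
  rw [mhs, esymmIcc, Finset.sum_mul]
  refine Finset.sum_nbij' (fun s => Finset.Icc 1 m \ s) (fun s => Finset.Icc 1 m \ s)
    ?_ ?_ ?_ ?_ ?_
  · intro s hs
    rw [Finset.mem_powersetCard] at *
    exact ⟨Finset.sdiff_subset, by rw [Finset.card_sdiff_of_subset hs.1, hcard, hs.2]⟩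
  · intro s hs
    rw [Finset.mem_powersetCard] at *
    refine ⟨Finset.sdiff_subset, ?_⟩
    rw [Finset.card_sdiff_of_subset hs.1, hcard, hs.2]
    omega
  · intro s hs
    exact Finset.sdiff_sdiff_eq_self (Finset.mem_powersetCard.1 hs).1
  · intro s hs
    exact Finset.sdiff_sdiff_eq_self (Finset.mem_powersetCard.1 hs).1
  · intro s hs
    have hs' := (Finset.mem_powersetCard.1 hs).1
    have hne : ∏ i ∈ s, (i : ℚ) ≠ 0 := Finset.prod_ne_zero_iff.2 fun i hi => by
      have := Finset.mem_Icc.1 (hs' hi)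
      exact_mod_cast (by omega : i ≠ 0)
    rw [cast_factorial_eq_prod_Icc, ← Finset.prod_sdiff hs', Finset.prod_div_distrib]
    field_simp
    simp

section

variable {p : ℕ} [hp : Fact p.Prime]

theorem factorial_inv_mem_pIntegral {m : ℕ} (hm : m < p) :
    (m.factorial : ℚ)⁻¹ ∈ pIntegral p := by
  have h : padicNorm p (m.factorial : ℚ) = 1 :=
    (padicNorm.nat_eq_one_iff _).2 fun h => by
      have := (hp.out.dvd_factorial).1 h
      omega
  rw [mem_pIntegral, ← one_div, padicNorm.div, h]
  simp

theorem mhs_mem_pIntegral (j : ℕ) : mhs j (p - 1) ∈ pIntegral p := by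
  refine sum_mem fun s hs => prod_mem fun i hi => ?_
  have := Finset.mem_Icc.1 ((Finset.mem_powersetCard.1 hs).1 hi)
  rw [one_div]
  exact natCast_inv_mem_pIntegral (by omega) (by omega)

theorem esymmIcc_mem_pIntegral (j m : ℕ) : esymmIcc j m ∈ pIntegral p :=
  sum_mem fun _ _ => prod_mem fun _ _ => natCast_mem _ _

theorem sum_Icc_pow_eq_sum_range {r : ℕ} (hr : 0 < r) :
    ∑ i ∈ Finset.Icc 1 (p - 1), (i : ℚ) ^ r = ∑ i ∈ range p, (i : ℚ) ^ r := by
  refine Finset.sum_subset (fun i hi => ?_) fun i hi hi' => ?_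
  · have := Finset.mem_Icc.1 hi
    have := hp.out.pos
    exact Finset.mem_range.2 (by omega)
  · have := Finset.mem_range.1 hi
    obtain rfl : i = 0 := by
      by_contra h
      exact hi' (Finset.mem_Icc.2 (by omega))
    simp [hr.ne']

theorem exists_sum_Icc_pow_eq_prime_mul {r : ℕ} (hr : 0 < r) (hrp : r + 2 ≤ p) :
    ∃ w ∈ pIntegral p, ∑ i ∈ Finset.Icc 1 (p - 1), (i : ℚ) ^ r = p * w := by
  obtain ⟨w, hw, h⟩ := sum_range_pow_eq_prime_mul_bernoulli_add r hrp
  refine ⟨_root_.bernoulli r + p * w,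
    add_mem (bernoulli_mem_pIntegral r hrp) (mul_mem (natCast_mem _ _) hw), ?_⟩
  rw [sum_Icc_pow_eq_sum_range hr, h]
  ring

theorem exists_sum_eq_mul {ι : Type*} (s : Finset ι) (f : ι → ℚ) (c : ℚ)
    (h : ∀ i ∈ s, ∃ w ∈ pIntegral p, f i = c * w) :
    ∃ w ∈ pIntegral p, ∑ i ∈ s, f i = c * w := by
  choose! w hw hf using h
  exact ⟨∑ i ∈ s, w i, sum_mem hw, by rw [Finset.mul_sum]; exact Finset.sum_congr rfl hf⟩

theorem exists_esymmIcc_eq_prime_mul {r : ℕ} (hr : 0 < r) (hrp : r + 2 ≤ p) :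
    ∃ w ∈ pIntegral p, esymmIcc r (p - 1) = p * w := by
  obtain ⟨w, hw, h⟩ := exists_sum_eq_mul (p := p) {a ∈ antidiagonal r | a.1 < r}
    (fun a => (-1) ^ a.1 * esymmIcc a.1 (p - 1) * ∑ i ∈ Finset.Icc 1 (p - 1), (i : ℚ) ^ a.2) p
    (by
      intro a ha
      simp only [Finset.mem_filter, Finset.HasAntidiagonal.mem_antidiagonal] at ha
      obtain ⟨w, hw, h⟩ := exists_sum_Icc_pow_eq_prime_mul (p := p) (r := a.2)
        (by omega) (by omega)
      refine ⟨(-1) ^ a.1 * esymmIcc a.1 (p - 1) * w, mul_mem (mul_mem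
        (pow_mem (neg_mem (one_mem _)) _) (esymmIcc_mem_pIntegral _ _)) hw, ?_⟩
      simp only [h]
      ring)
  refine ⟨(r : ℚ)⁻¹ * ((-1) ^ (r + 1) * w), mul_mem (natCast_inv_mem_pIntegral hr (by omega))
    (mul_mem (pow_mem (neg_mem (one_mem _)) _) hw), ?_⟩
  have hr' : (r : ℚ) ≠ 0 := by positivity
  have := mul_esymmIcc_eq_sum r (p - 1)
  rw [h] at this
  field_simp
  linear_combination this

theorem exists_mul_esymmIcc_eq_bernoulli {r : ℕ} (hr : 0 < r) (hrp : r + 2 ≤ p) :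
    ∃ w ∈ pIntegral p, r * esymmIcc r (p - 1) =
      (-1) ^ (r + 1) * (p * _root_.bernoulli r) + (p : ℚ) ^ 2 * w := by
  obtain ⟨w, hw, h⟩ := exists_sum_eq_mul (p := p) ({a ∈ antidiagonal r | a.1 < r}.erase (0, r))
    (fun a => (-1) ^ a.1 * esymmIcc a.1 (p - 1) * ∑ i ∈ Finset.Icc 1 (p - 1), (i : ℚ) ^ a.2)
    ((p : ℚ) ^ 2)
    (by
      rintro ⟨a, b⟩ ha
      simp only [Finset.mem_erase, Finset.mem_filter, Finset.HasAntidiagonal.mem_antidiagonal, ne_eq,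
        Prod.mk.injEq, not_and] at ha
      obtain ⟨w, hw, h⟩ := exists_sum_Icc_pow_eq_prime_mul (p := p) (r := b)
        (by omega) (by omega)
      obtain ⟨v, hv, h'⟩ := exists_esymmIcc_eq_prime_mul (p := p) (r := a)
        (by omega) (by omega)
      refine ⟨(-1) ^ a * v * w, mul_mem (mul_mem
        (pow_mem (neg_mem (one_mem _)) _) hv) hw, ?_⟩
      simp only [h, h']
      ring)
  obtain ⟨v, hv, h'⟩ := sum_range_pow_eq_prime_mul_bernoulli_add (p := p) r hrp
  refine ⟨(-1) ^ (r + 1) * (v + w), mul_mem (pow_mem (neg_mem (one_mem _)) _) (add_mem hv hw), ?_⟩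
  rw [mul_esymmIcc_eq_sum, ← Finset.add_sum_erase _ _ (a := (0, r)) (by simp [hr]), h,
    sum_Icc_pow_eq_sum_range hr, h', esymmIcc_zero]
  ring

end

theorem prod_one_add_mul_inv (x : ℚ) (m : ℕ) :
    ∏ i ∈ Finset.Icc 1 m, (1 + x * (1 / (i : ℚ))) = ∑ j ∈ range (m + 1), x ^ j * mhs j m := by
  rw [Finset.prod_one_add, Finset.sum_powerset]
  simp only [Nat.card_Icc, Nat.add_sub_cancel]
  refine Finset.sum_congr rfl fun j _ => ?_
  rw [mhs, Finset.mul_sum]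
  refine Finset.sum_congr rfl fun s hs => ?_
  rw [Finset.prod_mul_distrib, Finset.prod_const, (Finset.mem_powersetCard.1 hs).2]

theorem ringChoose_sub_one_eq_prod (y : ℚ) (m : ℕ) :
    Ring.choose (y - 1) m = ∏ i ∈ Finset.Icc 1 m, ((y - i) / i) := by
  have h := Ring.descPochhammer_eq_factorial_smul_choose (y - 1) m
  have hm : (m.factorial : ℚ) ≠ 0 := by positivity
  have hd : (descPochhammer ℤ m).smeval (y - 1) = ∏ i ∈ Finset.Icc 1 m, (y - i) := by
    rw [← Polynomial.aeval_eq_smeval, Polynomial.aeval_def, ← Polynomial.eval_map,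
      descPochhammer_map, descPochhammer_eval_eq_prod_range]
    change _ = ∏ i ∈ Finset.Ico 1 (m + 1), (y - (i : ℚ))
    rw [Finset.prod_Ico_eq_prod_range, Nat.add_sub_cancel]
    refine Finset.prod_congr rfl fun i _ => ?_
    push_cast
    ring
  rw [Finset.prod_div_distrib, ← cast_factorial_eq_prod_Icc, ← hd, h, nsmul_eq_mul]
  field_simp

theorem prod_Icc_sub_eq_prod_Icc_add (p : ℕ) (y : ℚ) :
    ∏ i ∈ Finset.Icc 1 (p - 1), (y - i) = ∏ i ∈ Finset.Icc 1 (p - 1), (y - p + i) := by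
  refine Finset.prod_nbij' (fun i => p - i) (fun i => p - i) ?_ ?_ ?_ ?_ ?_
  · intro i hi
    simp only [Finset.mem_Icc] at *
    omega
  · intro i hi
    simp only [Finset.mem_Icc] at *
    omega
  · intro i hi
    simp only [Finset.mem_Icc] at *
    omega
  · intro i hi
    simp only [Finset.mem_Icc] at *
    omega
  · intro i hi
    simp only [Finset.mem_Icc] at *
    rw [Nat.cast_sub (by omega)]
    ring

/-- The expansion of `binom(xp - 1, p - 1)` in powers of `x - 1`. -/
theorem ringChoose_eq_sum_sub_one_pow {p : ℕ} (hp : 0 < p) (x : ℚ) :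
    Ring.choose (x * p - 1) (p - 1) =
      ∑ j ∈ range p, (x - 1) ^ j * ((p : ℚ) ^ j * mhs j (p - 1)) := by
  have h := prod_one_add_mul_inv ((x - 1) * p) (p - 1)
  rw [Nat.sub_add_cancel hp] at h
  simp only [← mul_assoc, ← mul_pow]
  rw [← h, ringChoose_sub_one_eq_prod, Finset.prod_div_distrib, prod_Icc_sub_eq_prod_Icc_add,
    ← Finset.prod_div_distrib]
  refine Finset.prod_congr rfl fun i hi => ?_
  have : (i : ℚ) ≠ 0 := by
    have := Finset.mem_Icc.1 hi
    exact_mod_cast (by omega : i ≠ 0)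
  field_simp
  ring

/-- The expansion of `binom(xp - 1, p - 1)` in powers of `x`. -/
theorem ringChoose_eq_sum_pow {p : ℕ} (hp : Odd p) (x : ℚ) :
    Ring.choose (x * p - 1) (p - 1) =
      ∑ j ∈ range p, (-1) ^ j * x ^ j * ((p : ℚ) ^ j * mhs j (p - 1)) := by
  have h := prod_one_add_mul_inv (-1 * x * p) (p - 1)
  rw [Nat.sub_add_cancel hp.pos] at h
  simp only [← mul_assoc, ← mul_pow]
  have he : ∏ i ∈ Finset.Icc 1 (p - 1), (-1 : ℚ) = 1 := by
    rw [Finset.prod_const, Nat.card_Icc, Nat.add_sub_cancel]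
    exact (hp.tsub_odd odd_one).neg_one_pow
  have hs : ∏ i ∈ Finset.Icc 1 (p - 1), ((x * p - i) / i) =
      (∏ i ∈ Finset.Icc 1 (p - 1), (-1 : ℚ)) * ∏ i ∈ Finset.Icc 1 (p - 1), ((x * p - i) / i) := by
    rw [he, one_mul]
  rw [← h, ringChoose_sub_one_eq_prod, hs, ← Finset.prod_mul_distrib]
  refine Finset.prod_congr rfl fun i hi => ?_
  have : (i : ℚ) ≠ 0 := by
    have := Finset.mem_Icc.1 hi
    exact_mod_cast (by omega : i ≠ 0)
  field_simp
  ring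

theorem degree_sub_mul_sum_lt {R S : Type*} [CommRing R] [CommRing S] [Nontrivial S]
    (f : R →+* S) {M : R[X]} (hM : M.Monic) (a : ℕ → S) (s : Finset ℕ) :
    (∑ j ∈ s, C (a j) * X ^ j - M.map f * ∑ j ∈ s, C (a j) * (X ^ j /ₘ M).map f).degree
      < M.natDegree := by
  rw [Finset.mul_sum, ← Finset.sum_sub_distrib, ← Polynomial.mem_degreeLT]
  refine sum_mem fun j _ => ?_
  have h : C (a j) * X ^ j - M.map f * (C (a j) * (X ^ j /ₘ M).map f) =
      a j • ((X ^ j) %ₘ M.map f) := by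
    have h1 := Polynomial.modByMonic_add_div (X ^ j : S[X]) (M.map f)
    rw [Polynomial.map_divByMonic f hM, Polynomial.map_pow, Polynomial.map_X,
      Polynomial.smul_eq_C_mul]
    linear_combination (-C (a j)) * h1
  rw [h]
  refine Submodule.smul_mem _ _ (Polynomial.mem_degreeLT.2 ?_)
  rw [← hM.natDegree_map f, ← Polynomial.degree_eq_natDegree (hM.map f).ne_zero]
  exact Polynomial.degree_modByMonic_lt _ (hM.map f)

/-- The monic polynomial `(T(T - 1))^m`. -/
theorem X_pow_mul_X_sub_one_pow_monic {R : Type*} [CommRing R] (m : ℕ) :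
    (X ^ m * (X - 1) ^ m : R[X]).Monic :=
  (monic_X_pow m).mul (by simpa using (monic_X_sub_C (1 : R)).pow m)

theorem natDegree_X_pow_mul_X_sub_one_pow {R : Type*} [CommRing R] [Nontrivial R] (m : ℕ) :
    (X ^ m * (X - 1) ^ m : R[X]).natDegree = 2 * m := by
  have h : (X - 1 : R[X]).Monic := by simpa using monic_X_sub_C (1 : R)
  have h1 : (X - 1 : R[X]).natDegree = 1 := by simpa using natDegree_X_sub_C (1 : R)
  rw [(monic_X_pow m).natDegree_mul (h.pow m), h.natDegree_pow, h1, natDegree_X_pow]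
  ring

theorem X_pow_divByMonic_eq_one {R : Type*} [CommRing R] [Nontrivial R] {M : R[X]} {N : ℕ}
    (hM : M.Monic) (hN : M.natDegree = N) : X ^ N /ₘ M = 1 := by
  refine (Polynomial.div_modByMonic_unique 1 (X ^ N - M) hM ⟨by ring, ?_⟩).1
  have hd : (X ^ N : R[X]).degree = M.degree := by
    rw [degree_X_pow, degree_eq_natDegree hM.ne_zero, hN]
  rw [← hd]
  exact degree_sub_lt_left hd (monic_X_pow N).ne_zero 
    (by rw [(monic_X_pow N).leadingCoeff, hM.leadingCoeff])

theorem dvd_sum_sub_sum {R : Type*} [CommRing R] {n N : ℕ} (hN : n + 1 ≤ N) (Y : R)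
    (c g b : ℕ → R) (hg : ∀ j, n + 1 ≤ j → Y ∣ g j) (hb : ∀ j ≤ n, Y ∣ b j - g j) :
    Y ∣ ∑ j ∈ range N, c j * g j - ∑ j ∈ range (n + 1), c j * b j := by
  rw [← Finset.sum_range_add_sum_Ico _ hN, add_sub_right_comm, ← Finset.sum_sub_distrib]
  refine dvd_add (Finset.dvd_sum fun j hj => ?_) (Finset.dvd_sum fun j hj => ?_)
  · rw [← mul_sub]
    exact ((dvd_sub_comm).1 (hb j (by simpa [Nat.lt_succ_iff] using hj))).mul_left _
  · exact (hg j (Finset.mem_Ico.1 hj).1).mul_left _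

theorem exists_eval_sub_extremal_eq {n N : ℕ} (hN : 2 * n + 2 < N) (c : ℕ → ℚ) (b : ℕ → ℚ[X])
    (hdeg : ∀ j ≤ n, (b j).natDegree ≤ 2 * n + 1)
    (hb1 : ∀ j ≤ n, (X - 1) ^ (n + 1) ∣ b j - (X - 1) ^ j)
    (hb2 : ∀ j ≤ n, X ^ (n + 1) ∣ b j - (-1) ^ j * X ^ j)
    (hc : ∑ j ∈ range N, C (c j) * (X - 1) ^ j = ∑ j ∈ range N, C (c j) * ((-1) ^ j * X ^ j))
    (k : ℤ) : ∃ z : ℕ → ℤ,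
      ∑ j ∈ range N, c j * (k - 1) ^ j - ∑ j ∈ range (n + 1), c j * (b j).eval (k : ℚ) =
        k ^ (n + 1) * (k - 1) ^ (n + 1) *
          (c (2 * n + 2) + ∑ j ∈ Finset.Ico (2 * n + 3) N, c j * z j) := by
  set M : ℤ[X] := X ^ (n + 1) * (X - 1) ^ (n + 1) with hMdef
  have hM : M.Monic := X_pow_mul_X_sub_one_pow_monic _
  have hMd : M.natDegree = 2 * n + 2 := natDegree_X_pow_mul_X_sub_one_pow _
  set f := Int.castRingHom ℚ
  have hMf : M.map f = X ^ (n + 1) * (X - 1) ^ (n + 1) := by simp [hMdef]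
  set D : ℚ[X] := ∑ j ∈ range N, C (c j) * (X - 1) ^ j - ∑ j ∈ range (n + 1), C (c j) * b j
    with hD
  have hdvd : M.map f ∣ D := by
    rw [hMf]
    refine IsCoprime.mul_dvd (IsCoprime.pow ⟨1, -1, by ring⟩) ?_ ?_
    · rw [hD, hc]
      exact dvd_sum_sub_sum (by omega) _ _ (fun j => (-1) ^ j * X ^ j) _
        (fun j hj => (pow_dvd_pow _ hj).mul_left _) hb2
    · exact dvd_sum_sub_sum (by omega) _ _ (fun j => (X - 1) ^ j) _
        (fun j hj => pow_dvd_pow _ hj) hb1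
  set a : ℕ → ℚ := fun j => c j * (-1) ^ j with ha
  set Q : ℚ[X] := ∑ j ∈ Finset.Ico (2 * n + 2) N, C (a j) * (X ^ j /ₘ M).map f with hQ
  have hlow : (D - M.map f * Q).degree < (M.map f).degree := by
    rw [degree_eq_natDegree (hM.map f).ne_zero, hM.natDegree_map, hMd,
      ← Polynomial.mem_degreeLT]
    have h : D - M.map f * Q = (∑ j ∈ range (2 * n + 2), C (a j) * X ^ j -
        ∑ j ∈ range (n + 1), C (c j) * b j) +
        (∑ j ∈ Finset.Ico (2 * n + 2) N, C (a j) * X ^ j - M.map f * Q) := by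
      have : ∀ j, C (c j) * ((-1) ^ j * X ^ j) = C (a j) * X ^ j := by
        intro j
        simp [ha, mul_assoc]
      rw [hD, hc, Finset.sum_congr rfl fun j _ => this j,
        ← Finset.sum_range_add_sum_Ico (fun j => C (a j) * X ^ j) hN.le]
      ring
    rw [h]
    refine add_mem (sub_mem (sum_mem fun j hj => ?_) (sum_mem fun j hj => ?_)) ?_
    · rw [← Polynomial.smul_eq_C_mul]
      refine Submodule.smul_mem _ _ (Polynomial.mem_degreeLT.2 ?_)
      rw [degree_X_pow]
      exact_mod_cast Finset.mem_range.1 hj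
    · rw [← Polynomial.smul_eq_C_mul]
      refine Submodule.smul_mem _ _ (Polynomial.mem_degreeLT.2 ?_)
      have := hdeg j (Nat.lt_succ_iff.1 (Finset.mem_range.1 hj))
      refine (degree_le_natDegree).trans_lt ?_
      exact_mod_cast (by omega : (b j).natDegree < 2 * n + 2)
    · have h2 := degree_sub_mul_sum_lt f hM a (Finset.Ico (2 * n + 2) N)
      rw [← hQ, hMd] at h2
      exact Polynomial.mem_degreeLT.2 h2
  have h0 : D = M.map f * Q :=
    sub_eq_zero.1 (Polynomial.eq_zero_of_dvd_of_degree_lt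
      (dvd_sub hdvd (dvd_mul_right _ _)) hlow)
  refine ⟨fun j => (-1) ^ j * (X ^ j /ₘ M).eval k, ?_⟩
  have he := congrArg (Polynomial.eval (k : ℚ)) h0
  rw [hMf, hQ, Finset.sum_eq_sum_Ico_succ_bot hN, X_pow_divByMonic_eq_one hM hMd] at he
  have hev : ∀ q : ℤ[X], (q.map f).eval (k : ℚ) = ((q.eval k : ℤ) : ℚ) := fun q => by
    simp
  have heven : (-1 : ℚ) ^ (2 * n + 2) = 1 := Even.neg_one_pow ⟨n + 1, by ring⟩
  simp only [hD, ha, eval_sub, eval_finsetSum, eval_mul, eval_C, eval_pow, eval_X, eval_one,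
    eval_add, Polynomial.map_one, hev, heven, mul_one] at he
  rw [he]
  push_cast
  simp only [mul_assoc]


section

variable {p : ℕ} [hp : Fact p.Prime]

theorem exists_mhs_eq_prime_mul {j : ℕ} (hj : 0 < j) (hjp : j + 2 ≤ p) :
    ∃ h ∈ pIntegral p, mhs j (p - 1) = p * h := by
  obtain ⟨w, hw, h⟩ := exists_esymmIcc_eq_prime_mul (p := p) (r := p - 1 - j)
    (by omega) (by omega)
  have hm := mhs_mul_factorial (j := j) (m := p - 1) (by omega)
  have hf : ((p - 1).factorial : ℚ) ≠ 0 := by positivity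
  refine ⟨w * ((p - 1).factorial : ℚ)⁻¹,
    mul_mem hw (factorial_inv_mem_pIntegral (by omega)), ?_⟩
  rw [h] at hm
  field_simp
  exact hm

theorem padicNorm_prime_mul_lt_one {w : ℚ} (hw : w ∈ pIntegral p) : padicNorm p (p * w) < 1 := by
  rw [padicNorm.mul]
  exact mul_lt_one_of_nonneg_of_lt_one_left (padicNorm.nonneg _)
    padicNorm.padicNorm_p_lt_one_of_prime hw

theorem padicNorm_add_prime_mul_lt_one_iff {x w : ℚ} (hw : w ∈ pIntegral p) :
    padicNorm p (x + p * w) < 1 ↔ padicNorm p x < 1 := by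
  have hpw := padicNorm_prime_mul_lt_one hw
  refine ⟨fun h => ?_, fun h => padicNorm.nonarchimedean.trans_lt (max_lt h hpw)⟩
  have := (padicNorm.sub (p := p) (q := x + p * w) (r := p * w)).trans_lt (max_lt h hpw)
  rwa [add_sub_cancel_right] at this

theorem padicNorm_lt_one_iff_dvd_num {x : ℚ} : padicNorm p x < 1 ↔ (p : ℤ) ∣ x.num := by
  have h : padicNorm p x * padicNorm p (x.den : ℚ) = padicNorm p (x.num : ℚ) := by
    rw [← padicNorm.mul, Rat.mul_den_eq_num]
  rw [← padicNorm.int_lt_one_iff]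
  refine ⟨fun hx => ?_, fun hx => ?_⟩
  · rw [← h]
    exact mul_lt_one_of_nonneg_of_lt_one_left (padicNorm.nonneg _) hx (padicNorm.of_nat _)
  · have hd : padicNorm p (x.den : ℚ) = 1 := by
      rw [padicNorm.nat_eq_one_iff]
      intro hd
      have hn := Int.natCast_dvd.1 ((padicNorm.int_lt_one_iff _).1 hx)
      exact hp.out.one_lt.ne' (Nat.dvd_one.1 (x.reduced ▸ Nat.dvd_gcd hn hd))
    rwa [← h, hd, mul_one] at hx

theorem padicNorm_le_inv_prime_iff {x : ℚ} : padicNorm p x ≤ (p : ℚ)⁻¹ ↔ padicNorm p x < 1 := by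
  have hp1 : (1 : ℚ) < p := by exact_mod_cast hp.out.one_lt
  refine ⟨fun h => h.trans_lt (inv_lt_one_of_one_lt₀ hp1), fun h => ?_⟩
  by_cases hx : x = 0
  · simp [hx]
  obtain ⟨z, hz⟩ := padicNorm.values_discrete (p := p) hx
  rw [hz] at h ⊢
  rw [← zpow_neg_one]
  have : -z < 0 := by
    by_contra hlt
    exact absurd h (not_lt.2 (one_le_zpow₀ hp1.le (not_lt.1 hlt)))
  exact zpow_le_zpow_right₀ hp1.le (by omega)

theorem padicNorm_mul_lt_one_iff {x y : ℚ} (hx : x ∈ pIntegral p) (hy : y ∈ pIntegral p) :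
    padicNorm p (x * y) < 1 ↔ padicNorm p x < 1 ∨ padicNorm p y < 1 := by
  rw [padicNorm.mul]
  constructor
  · intro h
    by_contra! hc
    rw [le_antisymm hx hc.1, le_antisymm hy hc.2] at h
    norm_num at h
  · rintro (h | h)
    · exact mul_lt_one_of_nonneg_of_lt_one_left (padicNorm.nonneg _) h hy
    · exact mul_lt_one_of_nonneg_of_lt_one_right hx (padicNorm.nonneg _) h

theorem padicNorm_pow_lt_one_iff {x : ℚ} {m : ℕ} (hx : x ∈ pIntegral p) (hm : m ≠ 0) :
    padicNorm p (x ^ m) < 1 ↔ padicNorm p x < 1 := by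
  induction m with
  | zero => exact absurd rfl hm
  | succ m ih =>
    by_cases h : m = 0
    · simp [h]
    · rw [pow_succ, padicNorm_mul_lt_one_iff (pow_mem hx m) hx, ih h, or_self]

/-- The quotient `H({1}^j; p - 1) / p` vanishes modulo `p` exactly when `B_{p-1-j}` does. -/
theorem padicNorm_lt_one_iff_dvd_num_bernoulli {j : ℕ} (hj : 0 < j) (hjp : j + 2 ≤ p) {h : ℚ}
    (hmhs : mhs j (p - 1) = p * h) :
    padicNorm p h < 1 ↔ (p : ℤ) ∣ (_root_.bernoulli (p - 1 - j)).num := by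
  set r := p - 1 - j with hr
  obtain ⟨w, hw, he⟩ := exists_mul_esymmIcc_eq_bernoulli (p := p) (r := r) (by omega) (by omega)
  rw [← mhs_mul_factorial (by omega), hmhs] at he
  have hp0 : (p : ℚ) ≠ 0 := by exact_mod_cast hp.out.ne_zero
  have he' : ((r * (p - 1).factorial : ℕ) : ℚ) * h =
      (-1) ^ (r + 1) * _root_.bernoulli r + p * w := by
    apply mul_left_cancel₀ hp0
    push_cast
    linear_combination he
  have hu : padicNorm p ((r * (p - 1).factorial : ℕ) : ℚ) = 1 := by
    rw [padicNorm.nat_eq_one_iff, hp.out.dvd_mul, hp.out.dvd_factorial]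
    rintro (h | h)
    · exact Nat.not_dvd_of_pos_of_lt (by omega) (by omega) h
    · omega
  have hs : padicNorm p ((-1) ^ (r + 1) * _root_.bernoulli r) =
      padicNorm p (_root_.bernoulli r) := by
    rcases neg_one_pow_eq_or ℚ (r + 1) with h | h <;> simp [h]
  rw [← padicNorm_lt_one_iff_dvd_num, ← hs,
    ← padicNorm_add_prime_mul_lt_one_iff (x := _ * _root_.bernoulli r) hw, ← he',
    padicNorm.mul, hu, one_mul]

theorem exists_sum_mhs_mul_int_eq {j : ℕ} (hj : 0 < j) (hjp : j + 2 ≤ p) (z : ℕ → ℤ) :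
    ∃ w ∈ pIntegral p, ∑ i ∈ Finset.Ico j p, (p : ℚ) ^ i * mhs i (p - 1) * z i =
      (p : ℚ) ^ (j + 1) * w := by
  refine exists_sum_eq_mul _ _ _ fun i hi => ?_
  obtain ⟨hi, _⟩ := Finset.mem_Ico.1 hi
  rcases hi.eq_or_lt with rfl | hi
  · obtain ⟨h, hh, he⟩ := exists_mhs_eq_prime_mul (p := p) hj hjp
    exact ⟨h * z j, mul_mem hh (intCast_mem _ _), by rw [he]; ring⟩
  · refine ⟨(p : ℚ) ^ (i - (j + 1)) * mhs i (p - 1) * z i, mul_mem (mul_mem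
      (pow_mem (natCast_mem _ _) _) (mhs_mem_pIntegral i)) (intCast_mem _ _), ?_⟩
    rw [← mul_assoc, ← mul_assoc, ← pow_add, Nat.add_sub_cancel' hi]

end

theorem stmt3 (n : ℕ) (p : ℕ) (hp : p.Prime) (hp5 : 2 * n + 5 ≤ p) (k : ℤ)
    (b : ℕ → Polynomial ℚ)
    (hdeg : ∀ j ≤ n, (b j).natDegree ≤ 2 * n + 1)
    (hb1 : ∀ j ≤ n, (X - 1) ^ (n + 1) ∣ b j - (X - 1) ^ j)
    (hb2 : ∀ j ≤ n, X ^ (n + 1) ∣ b j - (-1) ^ j * X ^ j) :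
    padicNorm p (Ring.choose ((k : ℚ) * p - 1) (p - 1) -
        ∑ j ∈ Finset.range (n + 1), (b j).eval (k : ℚ) * (p : ℚ) ^ j * mhs j (p - 1))
      ≤ (p : ℚ) ^ (-(2 * (n : ℤ) + 4)) ↔
    ((p : ℤ) ∣ k ∨ (p : ℤ) ∣ (k - 1) ∨ (p : ℤ) ∣ (_root_.bernoulli (p - 2 * n - 3)).num) := by
  have : Fact p.Prime := ⟨hp⟩
  have hp0 : (0 : ℚ) < p := by exact_mod_cast hp.pos
  have hodd : Odd p := hp.odd_of_ne_two (by omega)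
  set c : ℕ → ℚ := fun j => (p : ℚ) ^ j * mhs j (p - 1) with hc
  have hpoly : ∑ j ∈ range p, C (c j) * (X - 1) ^ j =
      ∑ j ∈ range p, C (c j) * ((-1) ^ j * X ^ j) := by
    refine Polynomial.funext fun x => ?_
    simp only [eval_finsetSum, eval_mul, eval_C, eval_pow, eval_sub, eval_X, eval_one, eval_neg]
    simpa only [mul_comm] using
      (ringChoose_eq_sum_sub_one_pow hp.pos x).symm.trans (ringChoose_eq_sum_pow hodd x)
  obtain ⟨z, hz⟩ := exists_eval_sub_extremal_eq (by omega) c b hdeg hb1 hb2 hpoly k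
  obtain ⟨w, hw, hsum⟩ := exists_sum_mhs_mul_int_eq (p := p) (j := 2 * n + 3)
    (by omega) (by omega) z
  obtain ⟨h, hh, hmhs⟩ := exists_mhs_eq_prime_mul (p := p) (j := 2 * n + 2)
    (by omega) (by omega)
  have key : Ring.choose ((k : ℚ) * p - 1) (p - 1) -
      ∑ j ∈ Finset.range (n + 1), (b j).eval (k : ℚ) * (p : ℚ) ^ j * mhs j (p - 1) =
      (p : ℚ) ^ (2 * n + 3) * ((k : ℚ) ^ (n + 1) * (((k - 1 : ℤ) : ℚ) ^ (n + 1) * (h + p * w))) := by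
    have e1 : ∑ j ∈ Finset.range (n + 1), (b j).eval (k : ℚ) * (p : ℚ) ^ j * mhs j (p - 1) =
        ∑ j ∈ Finset.range (n + 1), c j * (b j).eval (k : ℚ) :=
      Finset.sum_congr rfl fun j _ => by simp only [hc]; ring
    have e2 : Ring.choose ((k : ℚ) * p - 1) (p - 1) = ∑ j ∈ range p, c j * ((k : ℚ) - 1) ^ j :=
      (ringChoose_eq_sum_sub_one_pow hp.pos _).trans
        (Finset.sum_congr rfl fun j _ => mul_comm _ _)
    rw [e1, e2, hz, hsum]
    simp only [hc, hmhs]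
    push_cast
    ring
  have hpow : (p : ℚ) ^ (-(2 * (n : ℤ) + 4)) = ((p : ℚ)⁻¹) ^ (2 * n + 3) * (p : ℚ)⁻¹ := by
    rw [← pow_succ, inv_pow, zpow_neg]
    norm_cast
  have hnorm : padicNorm p ((p : ℚ) ^ (2 * n + 3)) = ((p : ℚ)⁻¹) ^ (2 * n + 3) := by
    rw [← padicNorm.padicNorm_p_of_prime (p := p)]
    exact map_pow (IsAbsoluteValue.toAbsoluteValue (padicNorm p)) _ _
  have hy : h + p * w ∈ pIntegral p := add_mem hh (mul_mem (natCast_mem _ _) hw)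
  have hk1 : ((k - 1 : ℤ) : ℚ) ∈ pIntegral p := intCast_mem _ _
  have hk : (k : ℚ) ∈ pIntegral p := intCast_mem _ _
  rw [key, padicNorm.mul, hnorm, hpow, mul_le_mul_iff_right₀ (by positivity),
    padicNorm_le_inv_prime_iff,
    padicNorm_mul_lt_one_iff (pow_mem hk _) (mul_mem (pow_mem hk1 _) hy),
    padicNorm_mul_lt_one_iff (pow_mem hk1 _) hy,
    padicNorm_pow_lt_one_iff hk n.succ_ne_zero, padicNorm_pow_lt_one_iff hk1 n.succ_ne_zero,
    padicNorm.int_lt_one_iff, padicNorm.int_lt_one_iff, padicNorm_add_prime_mul_lt_one_iff hw,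
    padicNorm_lt_one_iff_dvd_num_bernoulli (by omega) (by omega) hmhs,
    show p - 1 - (2 * n + 2) = p - 2 * n - 3 by omega]
end

section
/- Let k be an integer, let c_0, c_1, c_2, ... be rational numbers, and for each j ≥ 0 define b_j := (k−1)^j + c_j + (−1)^{j+1} Σ_{i=0}^{j} binom(j, i)·c_i. Let p be an odd prime such that every c_i has p-adic valuation ≥ 0, and let N = p−3. Set E_N := binom(kp−1, p−1) − Σ_{j=0}^{N} b_j · p^j · H({1}^j; p−1). Then the p-adic valuation of E_N − ( (b_{N+1}/2 − b_{N+2}) · p^{N+2} ) is at least N+3. -/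
open Finset Polynomial

theorem mhs_zero_left (m : ℕ) : mhs 0 m = 1 := by
  simp [mhs]

theorem prod_Icc_natCast_eq_factorial (m : ℕ) :
    ∏ i ∈ Finset.Icc 1 m, (i : ℚ) = m.factorial := by
  induction m with
  | zero => simp
  | succ m ih =>
    rw [Finset.prod_Icc_succ_top (by omega), ih, Nat.factorial_succ]
    push_cast
    ring

theorem mhs_self_left (m : ℕ) : mhs m m = 1 / (m.factorial : ℚ) := by
  have h : Finset.powersetCard m (Finset.Icc 1 m) = {Finset.Icc 1 m} := by
    simpa using Finset.powersetCard_self (Finset.Icc 1 m)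
  rw [mhs, h, Finset.sum_singleton, Finset.prod_div_distrib, Finset.prod_const_one,
    prod_Icc_natCast_eq_factorial]

theorem mhs_succ_succ (j m : ℕ) :
    mhs (j + 1) (m + 1) = mhs (j + 1) m + mhs j m / ((m : ℚ) + 1) := by
  have hm : m + 1 ∉ Finset.Icc 1 m := by simp
  have hi : Finset.Icc 1 (m + 1) = insert (m + 1) (Finset.Icc 1 m) := by
    ext i
    simp only [Finset.mem_Icc, Finset.mem_insert]
    omega
  unfold mhs
  rw [hi, Finset.powersetCard_succ_insert hm, Finset.sum_union, Finset.sum_image, Finset.sum_div]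
  · congr 1
    refine Finset.sum_congr rfl fun s hs => ?_
    have : m + 1 ∉ s := fun h => hm ((Finset.mem_powersetCard.1 hs).1 h)
    rw [Finset.prod_insert this]
    push_cast
    ring
  · intro s hs t ht hst
    have hs' : m + 1 ∉ s := fun h => hm ((Finset.mem_powersetCard.1 hs).1 h)
    have ht' : m + 1 ∉ t := fun h => hm ((Finset.mem_powersetCard.1 ht).1 h)
    rw [← Finset.erase_insert hs', ← Finset.erase_insert ht', hst]
  · rw [Finset.disjoint_left]
    intro s hs ht
    obtain ⟨t, -, rfl⟩ := Finset.mem_image.1 ht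
    exact hm ((Finset.mem_powersetCard.1 hs).1 (Finset.mem_insert_self _ _))

theorem mhs_succ_right (m : ℕ) :
    mhs m (m + 1) = ((m : ℚ) + 1) * (m + 2) / 2 / ((m + 1).factorial : ℚ) := by
  induction m with
  | zero => simp [mhs_zero_left]
  | succ m ih =>
    rw [mhs_succ_succ, ih, mhs_self_left, Nat.factorial_succ (m + 1)]
    have : ((m + 1).factorial : ℚ) ≠ 0 := by positivity
    have : (m : ℚ) + 1 + 1 ≠ 0 := by positivity
    push_cast
    field_simp
    ring

/-- The generating function of the multiple harmonic sums `H({1}^j; m)`. -/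
theorem sum_mhs_smul_pow {A : Type*} [CommRing A] [Algebra ℚ A] (m : ℕ) (x : A) :
    ∑ j ∈ Finset.range (m + 1), mhs j m • x ^ j =
      ∏ i ∈ Finset.Icc 1 m, (1 + (1 / (i : ℚ)) • x) := by
  rw [Finset.prod_one_add, Finset.sum_powerset]
  simp only [Nat.card_Icc, Nat.add_sub_cancel]
  refine Finset.sum_congr rfl fun j _ => ?_
  rw [mhs, Finset.sum_smul]
  refine Finset.sum_congr rfl fun s hs => ?_
  rw [Finset.prod_smul, Finset.prod_const, (Finset.mem_powersetCard.1 hs).2]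

theorem sum_mhs_smul_pow_reflect {A : Type*} [CommRing A] [Algebra ℚ A] {m : ℕ} (hm : Even m)
    (x : A) :
    ∑ j ∈ Finset.range (m + 1), mhs j m • (-(m + 1 : A) - x) ^ j =
      ∑ j ∈ Finset.range (m + 1), mhs j m • x ^ j := by
  have key : ∀ y : A, ∏ i ∈ Finset.Icc 1 m, (1 + (1 / (i : ℚ)) • y) =
      (∏ i ∈ Finset.Icc 1 m, (1 / (i : ℚ))) • ∏ i ∈ Finset.Icc 1 m, ((i : A) + y) := by
    intro y
    rw [← Finset.prod_smul]
    refine Finset.prod_congr rfl fun i hi => ?_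
    have hi0 : (i : ℚ) ≠ 0 := by
      have := (Finset.mem_Icc.1 hi).1
      positivity
    rw [smul_add, ← map_natCast (algebraMap ℚ A) i, Algebra.algebraMap_eq_smul_one, smul_smul,
      one_div_mul_cancel hi0, one_smul]
  have reflect : ∏ i ∈ Finset.Icc 1 m, ((i : A) + (-(m + 1 : A) - x)) =
      ∏ i ∈ Finset.Icc 1 m, (-((i : A) + x)) := by
    refine Finset.prod_nbij' (fun i => m + 1 - i) (fun i => m + 1 - i) ?_ ?_ ?_ ?_ ?_
    · intro i hi
      simp only [Finset.mem_Icc] at hi ⊢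
      omega
    · intro i hi
      simp only [Finset.mem_Icc] at hi ⊢
      omega
    · intro i hi
      simp only [Finset.mem_Icc] at hi
      omega
    · intro i hi
      simp only [Finset.mem_Icc] at hi
      omega
    · intro i hi
      have : i ≤ m + 1 := by
        simp only [Finset.mem_Icc] at hi
        omega
      push_cast [Nat.cast_sub this]
      ring
  rw [sum_mhs_smul_pow, sum_mhs_smul_pow, key, key, reflect, Finset.prod_neg]
  simp [hm.neg_one_pow]

theorem ringChoose_eq_sum_mhs (x : ℚ) (m : ℕ) :
    Ring.choose (x + m) m = ∑ j ∈ Finset.range (m + 1), mhs j m * x ^ j := by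
  have h := sum_mhs_smul_pow m x
  simp only [smul_eq_mul] at h
  rw [h]
  have h1 : (m.factorial : ℚ) * Ring.choose (x + m) m = ∏ i ∈ Finset.Icc 1 m, ((i : ℚ) + x) := by
    rw [← nsmul_eq_mul, ← Ring.descPochhammer_eq_factorial_smul_choose]
    clear h
    induction m generalizing x with
    | zero => simp
    | succ m ih =>
      rw [Finset.prod_Icc_succ_top (by omega), mul_comm, ← ih, descPochhammer_succ_left]
      simp only [Polynomial.smeval_mul, Polynomial.smeval_X, pow_one, Polynomial.smeval_comp,
        Polynomial.smeval_sub, Polynomial.smeval_one, pow_zero]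
      push_cast
      congr 1
      · ring
      · congr 1
        simp
        ring
  have h3 : (m.factorial : ℚ) ≠ 0 := by positivity
  refine mul_left_cancel₀ h3 ?_
  rw [h1, ← prod_Icc_natCast_eq_factorial, ← Finset.prod_mul_distrib]
  refine Finset.prod_congr rfl fun i hi => ?_
  have hi0 : (i : ℚ) ≠ 0 := by
    have := (Finset.mem_Icc.1 hi).1
    positivity
  field_simp

/-- The umbral form of the symmetry `x ↦ -(m + 1) - x` of the generating function. -/
theorem sum_mhs_binomial_transform (c : ℕ → ℚ) {m : ℕ} (hm : Even m) :
    ∑ j ∈ Finset.range (m + 1), (c j + (-1 : ℚ) ^ (j + 1) *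
      ∑ i ∈ Finset.range (j + 1), (j.choose i : ℚ) * c i) * ((m : ℚ) + 1) ^ j * mhs j m = 0 := by
  let L : ℚ[X] →ₗ[ℚ] ℚ := (Polynomial.basisMonomials ℚ).constr ℚ c
  have hL : ∀ j, L (X ^ j) = c j := by
    intro j
    rw [Polynomial.X_pow_eq_monomial]
    simpa only [Polynomial.coe_basisMonomials] using
      (Polynomial.basisMonomials ℚ).constr_basis ℚ c j
  have h := congrArg L (sum_mhs_smul_pow_reflect hm (((m : ℚ) + 1) • (X : ℚ[X])))
  have e1 : ∀ j : ℕ, (-((m : ℚ[X]) + 1) - ((m : ℚ) + 1) • (X : ℚ[X])) ^ j =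
      ((-1) ^ j * ((m : ℚ) + 1) ^ j) • ∑ i ∈ Finset.range (j + 1), (j.choose i : ℚ) • X ^ i := by
    intro j
    have : -((m : ℚ[X]) + 1) - ((m : ℚ) + 1) • (X : ℚ[X]) = (-1 * ((m : ℚ) + 1)) • (X + 1) := by
      simp only [Polynomial.smul_eq_C_mul]
      simp
      ring
    rw [this, _root_.smul_pow, mul_pow, add_pow X 1 j]
    congr 1
    refine Finset.sum_congr rfl fun i _ => ?_
    simp only [Polynomial.smul_eq_C_mul]
    simp
    ring
  simp only [e1, _root_.smul_pow, map_sum, map_smul, hL, smul_eq_mul] at h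
  rw [eq_comm, ← sub_eq_zero, ← Finset.sum_sub_distrib] at h
  rw [← h]
  refine Finset.sum_congr rfl fun j _ => ?_
  ring

theorem ringChoose_eq_sum_mul_mhs (x : ℚ) (c : ℕ → ℚ) {m : ℕ} (hm : Even m) :
    Ring.choose (x * (m + 1) + m) m = ∑ j ∈ Finset.range (m + 1), (x ^ j + c j +
      (-1 : ℚ) ^ (j + 1) * ∑ i ∈ Finset.range (j + 1), (j.choose i : ℚ) * c i) *
        ((m : ℚ) + 1) ^ j * mhs j m := by
  rw [ringChoose_eq_sum_mhs, ← add_zero (Finset.sum _ _), ← sum_mhs_binomial_transform c hm,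
    ← Finset.sum_add_distrib]
  refine Finset.sum_congr rfl fun j _ => ?_
  rw [mul_pow]
  ring

/-- The rational numbers that are integral at `p`. -/
def padicIntegralSubring (p : ℕ) [Fact p.Prime] : Subring ℚ where
  carrier := {x | padicNorm p x ≤ 1}
  mul_mem' {x y} hx hy := by
    simp only [Set.mem_ofPred_eq, padicNorm.mul] at *
    exact mul_le_one₀ hx (padicNorm.nonneg y) hy
  one_mem' := by simp
  add_mem' hx hy := padicNorm.nonarchimedean.trans (max_le hx hy)
  zero_mem' := by simp
  neg_mem' {x} hx := by simpa using hx

theorem mem_padicIntegralSubring {p : ℕ} [Fact p.Prime] {x : ℚ} :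
    x ∈ padicIntegralSubring p ↔ padicNorm p x ≤ 1 := Iff.rfl

theorem mem_padicIntegralSubring_of_padicValRat {p : ℕ} [hp : Fact p.Prime] {x : ℚ}
    (hx : 0 ≤ padicValRat p x) : x ∈ padicIntegralSubring p := by
  rw [mem_padicIntegralSubring]
  by_cases h : x = 0
  · simp [h]
  · rw [padicNorm.eq_zpow_of_nonzero h]
    exact zpow_le_one_of_nonpos₀ (by exact_mod_cast hp.out.one_lt.le) (by omega)

theorem inv_natCast_mem_padicIntegralSubring {p n : ℕ} [Fact p.Prime] (h : ¬ p ∣ n) :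
    (1 / (n : ℚ)) ∈ padicIntegralSubring p := by
  rw [mem_padicIntegralSubring, padicNorm.div, (padicNorm.nat_eq_one_iff n).2 h]
  simp

theorem stmt12 (k : ℤ) (c : ℕ → ℚ) (b : ℕ → ℚ)
    (hb : ∀ j, b j = ((k : ℚ) - 1) ^ j + c j +
      (-1 : ℚ) ^ (j + 1) * ∑ i ∈ Finset.range (j + 1), (j.choose i : ℚ) * c i)
    (p : ℕ) (hp : p.Prime) (hodd : Odd p)
    (hc : ∀ i, 0 ≤ padicValRat p (c i)) :
    padicNorm p ((Ring.choose ((k : ℚ) * p - 1) (p - 1) -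
          ∑ j ∈ Finset.range (p - 3 + 1), b j * (p : ℚ) ^ j * mhs j (p - 1)) -
        (b (p - 2) / 2 - b (p - 1)) * (p : ℚ) ^ (p - 1))
      ≤ (p : ℚ) ^ (-(p : ℤ)) := by
  have : Fact p.Prime := ⟨hp⟩
  have hp3 : 3 ≤ p := by
    have := hp.two_le
    obtain ⟨r, rfl⟩ := hodd
    omega
  have hbS : ∀ j, b j ∈ padicIntegralSubring p := by
    intro j
    have hcS i := mem_padicIntegralSubring_of_padicValRat (hc i)
    rw [hb]
    refine add_mem (add_mem (pow_mem (sub_mem (intCast_mem _ k) (one_mem _)) _) (hcS j))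
      (mul_mem (pow_mem (neg_mem (one_mem _)) _) (sum_mem fun i _ => ?_))
    exact mul_mem (natCast_mem _ _) (hcS i)
  have huS : (1 / ((p - 1).factorial : ℚ)) ∈ padicIntegralSubring p := by
    refine inv_natCast_mem_padicIntegralSubring ?_
    rw [hp.dvd_factorial]
    omega
  have h2S : (1 / ((2 : ℕ) : ℚ)) ∈ padicIntegralSubring p :=
    inv_natCast_mem_padicIntegralSubring fun h => by
      have := Nat.le_of_dvd two_pos h
      omega
  obtain ⟨t, ht⟩ : (p : ℤ) ∣ ((p - 1).factorial : ℤ) + 1 := by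
    rw [← ZMod.intCast_zmod_eq_zero_iff_dvd _ p]
    push_cast
    rw [ZMod.wilsons_lemma]
    ring
  have htQ : ((p - 1).factorial : ℚ) + 1 = p * t := by exact_mod_cast ht
  obtain ⟨n, rfl⟩ : ∃ n, p = n + 3 := ⟨p - 3, by omega⟩
  simp only [show n + 3 - 1 = n + 2 by omega, show n + 3 - 2 = n + 1 by omega,
    show n + 3 - 3 = n by omega] at *
  have hm : Even (n + 2) := by
    obtain ⟨r, hr⟩ := hodd
    exact ⟨r, by omega⟩
  have hchoose := ringChoose_eq_sum_mul_mhs ((k : ℚ) - 1) c hm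
  simp only [← hb] at hchoose
  rw [Finset.sum_range_succ, Finset.sum_range_succ, mhs_self_left, mhs_succ_right] at hchoose
  have harg : (k : ℚ) * (n + 3 : ℕ) - 1 = (k - 1) * ((n + 2 : ℕ) + 1) + (n + 2 : ℕ) := by
    push_cast
    ring
  have hpQ : ((n + 3 : ℕ) : ℚ) = (n + 2 : ℕ) + 1 := by
    push_cast
    ring
  rw [harg, hchoose, hpQ]
  set u : ℚ := 1 / ((n + 2).factorial : ℚ) with hu
  have hfu : ((n + 2).factorial : ℚ) * u = 1 := by
    rw [hu]
    field_simp
  have hut : 1 + u = (n + 3) * t * u := by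
    push_cast at htQ
    linear_combination u * htQ - hfu
  have hmem : b (n + 1) * u * (1 - t) * (1 / ((2 : ℕ) : ℚ)) + b (n + 2) * t * u ∈
      padicIntegralSubring (n + 3) :=
    add_mem (mul_mem (mul_mem (mul_mem (hbS _) huS) (sub_mem (one_mem _) (intCast_mem _ t))) h2S)
      (mul_mem (mul_mem (hbS _) (intCast_mem _ t)) huS)
  have hfactor : ∑ j ∈ Finset.range (n + 1), b j * (((n + 2 : ℕ) : ℚ) + 1) ^ j * mhs j (n + 2) +
        b (n + 1) * (((n + 2 : ℕ) : ℚ) + 1) ^ (n + 1) *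
          ((((n + 1 : ℕ) : ℚ) + 1) * ((n + 1 : ℕ) + 2) / 2 / ((n + 1 + 1).factorial : ℚ)) +
        b (n + 2) * (((n + 2 : ℕ) : ℚ) + 1) ^ (n + 2) * u -
        ∑ j ∈ Finset.range (n + 1), b j * (((n + 2 : ℕ) : ℚ) + 1) ^ j * mhs j (n + 2) -
        (b (n + 1) / 2 - b (n + 2)) * (((n + 2 : ℕ) : ℚ) + 1) ^ (n + 2) =
      ((n + 3 : ℕ) : ℚ) ^ (n + 3) *
        (b (n + 1) * u * (1 - t) * (1 / ((2 : ℕ) : ℚ)) + b (n + 2) * t * u) := by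
    rw [div_eq_mul_one_div _ ((n + 1 + 1).factorial : ℚ), ← hu]
    push_cast
    linear_combination (b (n + 2) - b (n + 1) / 2) * ((n : ℚ) + 3) ^ (n + 2) * hut
  have hpow : padicNorm (n + 3) (((n + 3 : ℕ) : ℚ) ^ (n + 3)) ≤
      ((n + 3 : ℕ) : ℚ) ^ (-((n + 3 : ℕ) : ℤ)) := by
    have h := (padicNorm.dvd_iff_norm_le (p := n + 3) (n := n + 3)).1
      (dvd_refl (((n + 3) ^ (n + 3) : ℕ) : ℤ))
    exact_mod_cast h
  rw [hfactor, padicNorm.mul, ← hpQ]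
  exact (mul_le_of_le_one_right (padicNorm.nonneg _) hmem).trans hpow
end
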